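/- Let M ≥ 1, let K, K' be integers with K ≤ M−1 and K' ≤ M−1, let θ_1, …, θ_K ∈ [0,1) be pairwise distinct, let θ'_1, …, θ'_{K'} ∈ [0,1) be pairwise distinct, let p_1, …, p_K and p'_1, …, p'_{K'} be positive reals, and let σ, σ' ∈ ℝ^M have nonnegative entries. If Σ_{k=1}^K p_k · a(θ_k) a(θ_k)^H + diag(σ) = Σ_{j=1}^{K'} p'_j · a(θ'_j) a(θ'_j)^H + diag(σ') as M×M complex matrices, then K = K', σ = σ', and there exists a permutation π of {1,…,K} such that θ'_{π(k)} = θ_k and p'_{π(k)} = p_k for all k. -/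

import Mathlib

open Matrix

/-- The steering vector of an `M`-element ULA: `a(θ)_m = exp(2πi m θ)` for `m = 0, …, M-1`. -/
noncomputable def steering (M : ℕ) (θ : ℝ) : Fin M → ℂ :=
  fun m => Complex.exp (2 * (Real.pi : ℂ) * Complex.I * ((m : ℕ) : ℂ) * (θ : ℂ))

open Polynomial in
/-- The polynomial whose roots are the points `exp (2πi θ k)`, `k ∈ s`, of the unit circle. -/
noncomputable def nodePolynomial {ι : Type*} (s : Finset ι) (θ : ι → ℝ) : ℂ[X] :=
  ∏ k ∈ s, (X - C (Complex.exp (2 * Real.pi * Complex.I * θ k)))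

lemma nodePolynomial_monic {ι : Type*} (s : Finset ι) (θ : ι → ℝ) :
    (nodePolynomial s θ).Monic :=
  Polynomial.monic_prod_X_sub_C _ _

lemma natDegree_nodePolynomial {ι : Type*} (s : Finset ι) (θ : ι → ℝ) :
    (nodePolynomial s θ).natDegree = s.card :=
  Polynomial.natDegree_finsetProd_X_sub_C_eq_card s _

lemma exp_two_pi_I_mul_injOn :
    Set.InjOn (fun t : ℝ => Complex.exp (2 * Real.pi * Complex.I * t)) (Set.Ico 0 1) := by
  intro s hs t ht h
  obtain ⟨n, hn⟩ := Complex.exp_eq_exp_iff_exists_int.mp h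
  have h_eq : (s : ℂ) = t + n :=
    mul_left_cancel₀ Complex.two_pi_I_ne_zero (by rw [hn]; ring)
  have h_real : s = t + n := by exact_mod_cast h_eq
  have h_lt : (n : ℝ) < 1 := by linarith [hs.2, ht.1]
  have h_gt : (-1 : ℝ) < n := by linarith [hs.1, ht.2]
  have h_zero : n = 0 := by
    have : n < 1 := by exact_mod_cast h_lt
    have : -1 < n := by exact_mod_cast h_gt
    omega
  simpa [h_zero] using h_real

lemma eval_nodePolynomial_eq_zero_iff {ι : Type*} {s : Finset ι} {θ : ι → ℝ}
    (hθ : ∀ k, θ k ∈ Set.Ico (0 : ℝ) 1) {t : ℝ} (ht : t ∈ Set.Ico (0 : ℝ) 1) :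
    (nodePolynomial s θ).eval (Complex.exp (2 * Real.pi * Complex.I * t)) = 0 ↔
      ∃ k ∈ s, θ k = t := by
  simp only [nodePolynomial, Polynomial.eval_prod, Finset.prod_eq_zero_iff, Polynomial.eval_sub,
    Polynomial.eval_X, Polynomial.eval_C, sub_eq_zero]
  refine exists_congr fun k => and_congr_right fun _ => ⟨fun h => ?_, fun h => by rw [h]⟩
  exact exp_two_pi_I_mul_injOn (hθ k) ht h.symm

lemma steering_eq_pow (M : ℕ) (t : ℝ) (m : Fin M) :
    steering M t m = Complex.exp (2 * Real.pi * Complex.I * t) ^ (m : ℕ) := by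
  rw [steering, ← Complex.exp_nat_mul]
  congr 1
  ring

lemma coeff_dotProduct_steering {M : ℕ} {q : Polynomial ℂ} (hq : q.natDegree < M) (t : ℝ) :
    (fun m : Fin M => q.coeff m) ⬝ᵥ steering M t =
      q.eval (Complex.exp (2 * Real.pi * Complex.I * t)) := by
  rw [Polynomial.eval_eq_sum_range' hq, ← Fin.sum_univ_eq_sum_range
    (fun i => q.coeff i * Complex.exp (2 * Real.pi * Complex.I * t) ^ i)]
  simp only [dotProduct, steering_eq_pow]

lemma normSq_steering (M : ℕ) (t : ℝ) (m : Fin M) : Complex.normSq (steering M t m) = 1 := by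
  have h : 2 * (Real.pi : ℂ) * Complex.I * t = ((2 * Real.pi * t : ℝ) : ℂ) * Complex.I := by
    push_cast
    ring
  rw [steering_eq_pow, map_pow, Complex.normSq_eq_norm_sq, h, Complex.norm_exp_ofReal_mul_I]
  simp

/-- The covariance `∑ k, p k • a(θ k) a(θ k)ᴴ + diag σ`. -/
noncomputable def sourceCovariance {ι : Type*} [Fintype ι] {M : ℕ} (θ p : ι → ℝ)
    (σ : Fin M → ℝ) : Matrix (Fin M) (Fin M) ℂ :=
  (∑ k, (p k : ℂ) • vecMulVec (steering M (θ k)) (star (steering M (θ k))))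
    + diagonal (fun m => (σ m : ℂ))

lemma sourceCovariance_apply_self {ι : Type*} [Fintype ι] {M : ℕ} (θ p : ι → ℝ)
    (σ : Fin M → ℝ) (m : Fin M) :
    sourceCovariance θ p σ m m = ((∑ k, p k + σ m : ℝ) : ℂ) := by
  simp [sourceCovariance, Matrix.sum_apply, vecMulVec_apply, Complex.mul_conj, normSq_steering]

lemma dotProduct_sourceCovariance_mulVec_star {ι : Type*} [Fintype ι] {M : ℕ} (θ p : ι → ℝ)
    (σ : Fin M → ℝ) (c : Fin M → ℂ) :
    c ⬝ᵥ sourceCovariance θ p σ *ᵥ star c =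
      ((∑ k, p k * Complex.normSq (c ⬝ᵥ steering M (θ k))
        + ∑ m, σ m * Complex.normSq (c m) : ℝ) : ℂ) := by
  have h_source (t : ℝ) : c ⬝ᵥ vecMulVec (steering M t) (star (steering M t)) *ᵥ star c =
      (Complex.normSq (c ⬝ᵥ steering M t) : ℂ) := by
    rw [vecMulVec_mulVec, dotProduct_smul, star_dotProduct_star, ← Complex.mul_conj,
      starRingEnd_apply, op_smul_eq_mul]
  rw [sourceCovariance, add_mulVec, dotProduct_add, sum_mulVec, dotProduct_sum]
  simp only [smul_mulVec, dotProduct_smul, h_source, smul_eq_mul]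
  push_cast
  congr 1
  simp only [dotProduct, mulVec_diagonal, Pi.star_apply, ← Complex.mul_conj]
  refine Finset.sum_congr rfl fun m _ => ?_
  simp only [starRingEnd_apply]
  ring

/-- Equal covariances have equal quadratic forms, evaluated at the coefficient vector of a
polynomial of degree less than `M`. -/
lemma sum_normSq_eval_eq_of_sourceCovariance_eq {ι κ : Type*} [Fintype ι] [Fintype κ] {M : ℕ}
    {θ p : ι → ℝ} {θ' p' : κ → ℝ} {σ σ' : Fin M → ℝ}
    (h : sourceCovariance θ p σ = sourceCovariance θ' p' σ')
    {q : Polynomial ℂ} (hq : q.natDegree < M) :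
    ∑ k, p k * Complex.normSq (q.eval (Complex.exp (2 * Real.pi * Complex.I * θ k)))
        + ∑ m : Fin M, σ m * Complex.normSq (q.coeff m) =
      ∑ j, p' j * Complex.normSq (q.eval (Complex.exp (2 * Real.pi * Complex.I * θ' j)))
        + ∑ m : Fin M, σ' m * Complex.normSq (q.coeff m) := by
  have h_form := congrArg
    (fun R => (fun m : Fin M => q.coeff m) ⬝ᵥ R *ᵥ star (fun m : Fin M => q.coeff m)) h
  simp only [dotProduct_sourceCovariance_mulVec_star, coeff_dotProduct_steering hq] at h_form
  exact_mod_cast h_form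

lemma noise_eq_and_exists_frequency_eq {ι κ : Type*} [Fintype ι] [Fintype κ] {M : ℕ}
    (hι : Fintype.card ι < M) {θ p : ι → ℝ} {θ' p' : κ → ℝ} {σ σ' : Fin M → ℝ}
    (hθ : ∀ k, θ k ∈ Set.Ico (0 : ℝ) 1) (hθ' : ∀ j, θ' j ∈ Set.Ico (0 : ℝ) 1)
    (hp' : ∀ j, 0 < p' j) (h : sourceCovariance θ p σ = sourceCovariance θ' p' σ')
    (h_power : ∑ j, p' j ≤ ∑ k, p k) :
    σ = σ' ∧ ∀ j, ∃ k, θ k = θ' j := by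
  have h_noise (m : Fin M) : σ' m = σ m + (∑ k, p k - ∑ j, p' j) := by
    have h_diag := congrFun (congrFun h m) m
    rw [sourceCovariance_apply_self, sourceCovariance_apply_self] at h_diag
    linarith [Complex.ofReal_injective h_diag]
  set q := nodePolynomial Finset.univ θ
  have hq : q.natDegree < M := by simpa [q, natDegree_nodePolynomial] using hι
  have h_root (k : ι) : q.eval (Complex.exp (2 * Real.pi * Complex.I * θ k)) = 0 :=
    (eval_nodePolynomial_eq_zero_iff hθ (hθ k)).mpr ⟨k, Finset.mem_univ k, rfl⟩
  have h_form := sum_normSq_eval_eq_of_sourceCovariance_eq h hq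
  simp only [h_root, h_noise, add_mul, Finset.sum_add_distrib, map_zero, mul_zero,
    Finset.sum_const_zero, ← Finset.mul_sum] at h_form
  have h_source_nonneg (j : κ) (_ : j ∈ Finset.univ) : 0 ≤ p' j *
      Complex.normSq (q.eval (Complex.exp (2 * Real.pi * Complex.I * θ' j))) :=
    mul_nonneg (hp' j).le (Complex.normSq_nonneg _)
  have h_coeff_pos : 0 < ∑ m : Fin M, Complex.normSq (q.coeff m) := by
    refine Finset.sum_pos' (fun m _ => Complex.normSq_nonneg _)
      ⟨⟨q.natDegree, hq⟩, Finset.mem_univ _, ?_⟩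
    simp [(nodePolynomial_monic Finset.univ θ).coeff_natDegree, q]
  have h_sum_nonneg := Finset.sum_nonneg h_source_nonneg
  have h_gap_nonneg := mul_nonneg (sub_nonneg.mpr h_power) h_coeff_pos.le
  have h_gap : ∑ k, p k - ∑ j, p' j = 0 :=
    (mul_eq_zero.mp (by linarith)).resolve_right h_coeff_pos.ne'
  refine ⟨funext fun m => by rw [h_noise, h_gap, add_zero], fun j => ?_⟩
  have h_zero := (Finset.sum_eq_zero_iff_of_nonneg h_source_nonneg).mp (by linarith) j
    (Finset.mem_univ j)
  have h_eval := Complex.normSq_eq_zero.mp ((mul_eq_zero.mp h_zero).resolve_left (hp' j).ne')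
  obtain ⟨k, -, hk⟩ := (eval_nodePolynomial_eq_zero_iff hθ (hθ' j)).mp h_eval
  exact ⟨k, hk⟩

/-- With common frequencies and noise, the powers of at most `M` sources are determined. -/
lemma power_eq_of_sourceCovariance_eq {ι : Type*} [Fintype ι] {M : ℕ}
    (hι : Fintype.card ι ≤ M) {θ p p' : ι → ℝ} {σ : Fin M → ℝ}
    (hθ_inj : Function.Injective θ) (hθ : ∀ k, θ k ∈ Set.Ico (0 : ℝ) 1)
    (h : sourceCovariance θ p σ = sourceCovariance θ p' σ) : p = p' := by
  classical
  funext i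
  set q := nodePolynomial (Finset.univ.erase i) θ
  have hq : q.natDegree < M := by
    rw [natDegree_nodePolynomial]
    exact (Finset.card_erase_lt_of_mem (Finset.mem_univ i)).trans_le hι
  have h_form := add_right_cancel (sum_normSq_eval_eq_of_sourceCovariance_eq h hq)
  have h_root (k : ι) (hk : k ≠ i) :
      q.eval (Complex.exp (2 * Real.pi * Complex.I * θ k)) = 0 :=
    (eval_nodePolynomial_eq_zero_iff hθ (hθ k)).mpr ⟨k, by simp [hk], rfl⟩
  have h_ne : q.eval (Complex.exp (2 * Real.pi * Complex.I * θ i)) ≠ 0 := fun h_eval => by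
    obtain ⟨k, hk, hki⟩ := (eval_nodePolynomial_eq_zero_iff hθ (hθ i)).mp h_eval
    exact Finset.ne_of_mem_erase hk (hθ_inj hki)
  rw [Fintype.sum_eq_single i fun k hk => by simp [h_root k hk],
    Fintype.sum_eq_single i fun k hk => by simp [h_root k hk]] at h_form
  exact mul_right_cancel₀ (Complex.normSq_eq_zero.not.mpr h_ne) h_form

/-- Identifiability: the covariance `∑ k, p k • a(θ k) a(θ k)ᴴ + diag σ` with at most
`M - 1` sources (pairwise distinct frequencies in `[0,1)`, positive powers, nonnegative
noise variances) uniquely determines the parameters `(θ, p, σ)` up to permutation. -/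
theorem covariance_identifiability (M K K' : ℕ) (hM : 1 ≤ M)
    (hK : K ≤ M - 1) (hK' : K' ≤ M - 1)
    (θ : Fin K → ℝ) (θ' : Fin K' → ℝ) (p : Fin K → ℝ) (p' : Fin K' → ℝ)
    (σ σ' : Fin M → ℝ)
    (hθ : Function.Injective θ) (hθ' : Function.Injective θ')
    (hθmem : ∀ k, θ k ∈ Set.Ico (0 : ℝ) 1) (hθ'mem : ∀ j, θ' j ∈ Set.Ico (0 : ℝ) 1)
    (hp : ∀ k, 0 < p k) (hp' : ∀ j, 0 < p' j)
    (hσ : ∀ m, 0 ≤ σ m) (hσ' : ∀ m, 0 ≤ σ' m)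
    (heq : (∑ k, (p k : ℂ) • Matrix.vecMulVec (steering M (θ k)) (star (steering M (θ k))))
             + Matrix.diagonal (fun m => (σ m : ℂ))
         = (∑ j, (p' j : ℂ) • Matrix.vecMulVec (steering M (θ' j)) (star (steering M (θ' j))))
             + Matrix.diagonal (fun m => (σ' m : ℂ))) :
    K = K' ∧ σ = σ' ∧ ∃ e : Fin K ≃ Fin K', ∀ k, θ' (e k) = θ k ∧ p' (e k) = p k := by
  change sourceCovariance θ p σ = sourceCovariance θ' p' σ' at heq
  have hKM : Fintype.card (Fin K) < M := by rw [Fintype.card_fin]; omega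
  have hKM' : Fintype.card (Fin K') < M := by rw [Fintype.card_fin]; omega
  have h_noise : σ = σ' := by
    rcases le_total (∑ j, p' j) (∑ k, p k) with h | h
    · exact (noise_eq_and_exists_frequency_eq hKM hθmem hθ'mem hp' heq h).1
    · exact (noise_eq_and_exists_frequency_eq hKM' hθ'mem hθmem hp heq.symm h).1.symm
  subst h_noise
  have h_power : ∑ k, p k = ∑ j, p' j := by
    have h_diag := congrFun (congrFun heq ⟨0, hM⟩) ⟨0, hM⟩
    rw [sourceCovariance_apply_self, sourceCovariance_apply_self] at h_diag
    exact add_right_cancel (Complex.ofReal_injective h_diag)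
  choose g hg using
    (noise_eq_and_exists_frequency_eq hKM hθmem hθ'mem hp' heq h_power.ge).2
  choose f hf using
    (noise_eq_and_exists_frequency_eq hKM' hθ'mem hθmem hp heq.symm h_power.le).2
  let e : Fin K ≃ Fin K' :=
    { toFun := f
      invFun := g
      left_inv := fun k => hθ (by rw [hg, hf])
      right_inv := fun j => hθ' (by rw [hf, hg]) }
  have h_freq : θ' ∘ e = θ := funext hf
  have h_reindex : sourceCovariance θ' p' σ = sourceCovariance θ (p' ∘ e) σ := by
    rw [← h_freq]
    unfold sourceCovariance
    congr 1
    exact (Equiv.sum_comp e fun j =>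
      (p' j : ℂ) • vecMulVec (steering M (θ' j)) (star (steering M (θ' j)))).symm
  have h_powers := power_eq_of_sourceCovariance_eq hKM.le hθ hθmem (heq.trans h_reindex)
  refine ⟨by simpa using Fintype.card_congr e, rfl, e, fun k => ⟨hf k, ?_⟩⟩
  exact (congrFun h_powers k).symm
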